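/- There is an isomorphism of abelian groups between the abelianization K^{ab} of K and the direct sum ⊕_{j=1}^{k} ℤ[X]/(1 + X^{n/r_j} + X^{2n/r_j} + ⋯ + X^{(r_j − 1)n/r_j}) which carries the automorphism σ of K^{ab} induced by conjugation by γ_0 to multiplication by X; in other words, as a ℤ[X]-module (with X acting through σ), the abelianization of K is the direct sum of the cyclic modules ℤ[X]/(1 + X^{n/r_j} + ⋯ + X^{(r_j−1)n/r_j}) for j = 1, …, k. (Geometrically, K is the fundamental group of a cyclic covering C → ℙ¹ of degree n with two points of full ramification and inertia orders n, r_1, …, r_k, n, and the statement computes H_1(C, ℤ) as a ℤ[ℤ/n]-module.) -/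

import Mathlib

open Polynomial

/-- The relations of the polygonal orbifold group
`T = ⟨γ₀, γ₁, …, γ_k, γ_∞ ∣ γ₀ⁿ = γ₁^{r₁} = ⋯ = γ_k^{r_k} = γ_∞ⁿ = γ₀γ₁⋯γ_kγ_∞ = 1⟩`,
with generators indexed by `Fin (k+2)`: `0 ↦ γ₀`, `j.succ.castSucc ↦ γⱼ` for `j : Fin k`,
and `Fin.last (k+1) ↦ γ_∞`. -/
def bdfRels (n k : ℕ) (r : Fin k → ℕ) : Set (FreeGroup (Fin (k + 2))) :=
  {FreeGroup.of (0 : Fin (k + 2)) ^ n} ∪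
  {FreeGroup.of (Fin.last (k + 1)) ^ n} ∪
  (Set.range fun j : Fin k => FreeGroup.of (j.succ.castSucc : Fin (k + 2)) ^ r j) ∪
  {(List.ofFn fun i : Fin (k + 2) => FreeGroup.of i).prod}

def bdfRho (n : ℕ) [NeZero n] {A : Type*} [CommGroup A] (u : MulAut A)
    (hu : u ^ n = 1) :
    Multiplicative (ZMod n) →* MulAut A where
  toFun z := u ^ (Multiplicative.toAdd z).val
  map_one' := by simp
  map_mul' a b := by
    rw [toAdd_mul, ZMod.val_add, ← pow_eq_pow_mod _ hu, pow_add]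

theorem bdf_prod_reindex (n : ℕ) [NeZero n] {A : Type*} [CommMonoid A] (m : ZMod n)
    (f : ZMod n → A) :
    ∏ i ∈ Finset.range (addOrderOf m), f (i • m) =
      ∏ i ∈ Finset.range (addOrderOf m), f ((i * (n / addOrderOf m) : ℕ) : ZMod n) := by
  classical
  set r := addOrderOf m with hr
  have hrpos : 0 < r := addOrderOf_pos m
  have hrn : r ∣ n := by
    have := addOrderOf_dvd_card (x := m)
    rwa [ZMod.card] at this
  obtain ⟨d, hd⟩ := hrn
  have hnd : n / r = d := by rw [hd]; exact Nat.mul_div_cancel_left d hrpos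
  have hdpos : 0 < d := by
    rcases Nat.eq_zero_or_pos d with h | h
    · exact absurd (by rw [hd, h, mul_zero]) (NeZero.ne n)
    · exact h
  rw [hnd]
  have inj1 : Set.InjOn (fun i : ℕ => i • m) (Finset.range r) := by
    intro a ha b hb hab
    simp only [Finset.coe_range, Set.mem_Iio] at ha hb
    exact nsmul_injOn_Iio_addOrderOf ha hb hab
  have inj2 : Set.InjOn (fun i : ℕ => ((i * d : ℕ) : ZMod n)) (Finset.range r) := by
    intro a ha b hb hab
    simp only [Finset.coe_range, Set.mem_Iio] at ha hb
    have h1 := (ZMod.natCast_eq_natCast_iff' _ _ _).1 hab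
    rw [Nat.mod_eq_of_lt (by rw [hd]; exact Nat.mul_lt_mul_of_pos_right ha hdpos),
      Nat.mod_eq_of_lt (by rw [hd]; exact Nat.mul_lt_mul_of_pos_right hb hdpos)] at h1
    exact Nat.eq_of_mul_eq_mul_right hdpos h1
  have himg : (Finset.range r).image (fun i : ℕ => i • m) =
      (Finset.range r).image (fun i : ℕ => ((i * d : ℕ) : ZMod n)) := by
    apply Finset.eq_of_subset_of_card_le
    · intro z hz
      simp only [Finset.mem_image, Finset.mem_range] at hz ⊢
      obtain ⟨i, hi, rfl⟩ := hz
      have h0 : r • m = 0 := addOrderOf_nsmul_eq_zero m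
      have h1 : n ∣ r * m.val := by
        rw [← ZMod.natCast_eq_zero_iff]
        rw [Nat.cast_mul, ZMod.natCast_zmod_val, ← nsmul_eq_mul, h0]
      have h2 : d ∣ m.val := by
        have h3 : r * d ∣ r * m.val := by rwa [← hd]
        exact Nat.dvd_of_mul_dvd_mul_left hrpos h3
      obtain ⟨c, hc⟩ := h2
      refine ⟨(i * c) % r, Nat.mod_lt _ hrpos, ?_⟩
      have : i • m = ((i * m.val : ℕ) : ZMod n) := by
        rw [Nat.cast_mul, ZMod.natCast_zmod_val, nsmul_eq_mul]
      rw [this, ZMod.natCast_eq_natCast_iff']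
      rw [hc, hd, Nat.mul_mod_mul_right, show i * (d * c) = (i * c) * d by ring,
        Nat.mul_mod_mul_right, Nat.mod_mod]
    · rw [Finset.card_image_of_injOn inj1, Finset.card_image_of_injOn inj2]
  rw [← Finset.prod_image (f := f) (g := fun i : ℕ => i • m) inj1, himg,
    Finset.prod_image inj2]

theorem bdf_left_pow (n : ℕ) [NeZero n] {A : Type*} [CommGroup A] (u : MulAut A) (hu : u ^ n = 1)
    (g : A ⋊[bdfRho n u hu] Multiplicative (ZMod n)) (t : ℕ) :
    (g ^ t).left = ∏ i ∈ Finset.range t, (u ^ (i • Multiplicative.toAdd g.right).val) g.left := by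
  induction t with
  | zero => simp
  | succ t ih =>
    have hR : (g ^ t).right = g.right ^ t := map_pow SemidirectProduct.rightHom g t
    rw [pow_succ, SemidirectProduct.mul_left, ih, Finset.prod_range_succ, hR]
    rfl

theorem bdf_left_pow_order (n : ℕ) [NeZero n] {A : Type*} [CommGroup A] (u : MulAut A)
    (hu : u ^ n = 1)
    (g : A ⋊[bdfRho n u hu] Multiplicative (ZMod n)) (m : ZMod n)
    (hg : g.right = Multiplicative.ofAdd m) :
    (g ^ (addOrderOf m)).left =
      ∏ i ∈ Finset.range (addOrderOf m), (u ^ (i * (n / addOrderOf m))) g.left := by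
  rw [bdf_left_pow, hg]
  rw [toAdd_ofAdd, bdf_prod_reindex n m (fun z => (u ^ z.val) g.left)]
  refine Finset.prod_congr rfl fun i _ => ?_
  rw [ZMod.val_natCast, ← pow_eq_pow_mod _ hu]

theorem bdf_hom_ext {n k : ℕ} {r : Fin k → ℕ} {G : Type*} [Group G]
    (f g : PresentedGroup (bdfRels n k r) →* G)
    (h0 : f (PresentedGroup.of 0) = g (PresentedGroup.of 0))
    (hj : ∀ j : Fin k, f (PresentedGroup.of j.succ.castSucc) =
      g (PresentedGroup.of j.succ.castSucc)) : f = g := by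
  have hrel : (List.ofFn fun i : Fin (k + 2) =>
      (PresentedGroup.of i : PresentedGroup (bdfRels n k r))).prod = 1 := by
    have h : PresentedGroup.mk (bdfRels n k r)
        (List.ofFn fun i : Fin (k + 2) => FreeGroup.of i).prod = 1 :=
      PresentedGroup.one_of_mem (Or.inr rfl)
    rw [map_list_prod, List.map_ofFn] at h
    exact h
  have hc : ∀ i : Fin (k + 1), f (PresentedGroup.of i.castSucc) =
      g (PresentedGroup.of i.castSucc) := by
    intro i
    refine Fin.cases ?_ (fun j => ?_) i
    · exact h0
    · exact hj j
  have hf := congrArg f hrel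
  have hg := congrArg g hrel
  rw [map_list_prod, List.map_ofFn, List.ofFn_succ', List.concat_eq_append, List.prod_append, map_one] at hf hg
  have e : (fun i : Fin (k+1) => (⇑f ∘ fun i => PresentedGroup.of i) i.castSucc) =
     (fun i : Fin (k+1) => (⇑g ∘ fun i => PresentedGroup.of i) i.castSucc) := funext hc
  rw [e, ← hg] at hf
  have hl := mul_left_cancel hf
  simp only [List.prod_singleton, Function.comp] at hl
  refine PresentedGroup.ext fun i => ?_
  refine Fin.lastCases ?_ (fun j => ?_) i
  · exact hl
  · exact hc j

theorem bdf_exists_hom {n k : ℕ} {r : Fin k → ℕ} {G : Type*} [Group G]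
    (g0 : G) (gj : Fin k → G) (h0 : g0 ^ n = 1) (hj : ∀ j, gj j ^ r j = 1)
    (hp : (g0 * (List.ofFn gj).prod) ^ n = 1) :
    ∃ f : PresentedGroup (bdfRels n k r) →* G, f (PresentedGroup.of 0) = g0 ∧
      ∀ j : Fin k, f (PresentedGroup.of j.succ.castSucc) = gj j := by
  let g : Fin (k + 2) → G :=
    Fin.snoc (α := fun _ => G) (Fin.cons (α := fun _ => G) g0 gj) (g0 * (List.ofFn gj).prod)⁻¹
  have e0 : g 0 = g0 := by
    have : (0 : Fin (k+2)) = (0 : Fin (k+1)).castSucc := rfl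
    simp only [g]
    rw [this, Fin.snoc_castSucc, Fin.cons_zero]
  have ej : ∀ j : Fin k, g j.succ.castSucc = gj j := by
    intro j
    simp only [g]
    rw [Fin.snoc_castSucc, Fin.cons_succ]
  have el : g (Fin.last (k+1)) = (g0 * (List.ofFn gj).prod)⁻¹ := by
    simp only [g]
    rw [Fin.snoc_last]
  have hrels : ∀ w ∈ bdfRels n k r, FreeGroup.lift g w = 1 := by
    rintro w (((hw | hw) | ⟨j, rfl⟩) | hw)
    · rw [Set.mem_singleton_iff.1 hw, map_pow, FreeGroup.lift_apply_of, e0, h0]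
    · rw [Set.mem_singleton_iff.1 hw, map_pow, FreeGroup.lift_apply_of, el, inv_pow, hp, inv_one]
    · simp only
      rw [map_pow, FreeGroup.lift_apply_of, ej, hj]
    · rw [Set.mem_singleton_iff.1 hw, map_list_prod, List.map_ofFn, List.ofFn_succ',
        List.concat_eq_append, List.prod_append, List.ofFn_succ, List.prod_cons]
      simp only [Function.comp, FreeGroup.lift_apply_of, List.prod_singleton, ej, el]
      have : g (Fin.castSucc 0) = g0 := e0
      rw [this, mul_inv_cancel]
  refine ⟨PresentedGroup.toGroup hrels, ?_, fun j => ?_⟩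
  · rw [PresentedGroup.toGroup.of, e0]
  · rw [PresentedGroup.toGroup.of, ej]

theorem bdf_quot_hom {B : Type*} [AddCommGroup B] (s : Module.End ℤ B) (x : B) (f : ℤ[X])
    (hf : aeval s f x = 0) : ∃ β : (ℤ[X] ⧸ Ideal.span {f}) →+ B, β 1 = x ∧
      ∀ p, β (Ideal.Quotient.mk _ X * p) = s (β p) := by
  let b : ℤ[X] →+ B :=
    { toFun := fun p => aeval s p x
      map_zero' := by simp
      map_add' := by intro p q; simp }
  have hb : ∀ p ∈ Ideal.span {f}, b p = 0 := by
    intro p hp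
    obtain ⟨q, rfl⟩ := Ideal.mem_span_singleton'.1 hp
    change aeval s (q * f) x = 0
    rw [map_mul, Module.End.mul_apply, hf, map_zero]
  let β : (ℤ[X] ⧸ Ideal.span {f}) →+ B :=
    QuotientAddGroup.lift (Submodule.toAddSubgroup (Ideal.span {f})) b hb
  have hβ : ∀ p, β (Ideal.Quotient.mk _ p) = aeval s p x := fun p => rfl
  refine ⟨β, ?_, ?_⟩
  · have := hβ 1
    rw [map_one (aeval s), Module.End.one_apply] at this
    exact this
  · intro p
    obtain ⟨q, rfl⟩ := Ideal.Quotient.mk_surjective p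
    rw [← map_mul, hβ, hβ, map_mul, aeval_X, Module.End.mul_apply]

theorem bdf_quot_hom_ext {C : Type*} [AddCommGroup C] (s : C → C) {I : Ideal ℤ[X]}
    (f g : (ℤ[X] ⧸ I) →+ C) (h1 : f 1 = g 1)
    (hf : ∀ p, f (Ideal.Quotient.mk _ X * p) = s (f p))
    (hg : ∀ p, g (Ideal.Quotient.mk _ X * p) = s (g p)) : f = g := by
  ext p
  obtain ⟨q, rfl⟩ := Ideal.Quotient.mk_surjective p
  have hX : ∀ i : ℕ, f (Ideal.Quotient.mk _ (X ^ i)) = g (Ideal.Quotient.mk _ (X ^ i)) := by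
    intro i
    induction i with
    | zero => simpa using h1
    | succ i ih => rw [pow_succ', map_mul, hf, hg, ih]
  induction q using Polynomial.induction_on' with
  | add p q hp hq => rw [map_add, map_add, map_add, hp, hq]
  | monomial i a =>
    have : (monomial i a : ℤ[X]) = a • X ^ i := by
      rw [← C_mul_X_pow_eq_monomial, smul_eq_C_mul]
    rw [this, map_zsmul, map_zsmul, map_zsmul, hX]

theorem bdf_poly_full (d r : ℕ) :
    (∑ i ∈ Finset.range r, (X : ℤ[X]) ^ (i * d)) ∣ ∑ i ∈ Finset.range (r * d), (X : ℤ[X]) ^ i := by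
  refine ⟨∑ i ∈ Finset.range d, X ^ i, ?_⟩
  have hne : (X - 1 : ℤ[X]) ≠ 0 := by
    simpa using X_sub_C_ne_zero (1 : ℤ)
  apply mul_right_cancel₀ hne
  have h2 := geom_sum_mul (X ^ d : ℤ[X]) r
  simp only [← pow_mul] at h2
  rw [mul_assoc, geom_sum_mul, geom_sum_mul]
  have : ∑ i ∈ Finset.range r, (X : ℤ[X]) ^ (i * d) = ∑ i ∈ Finset.range r, (X : ℤ[X]) ^ (d * i) :=
    Finset.sum_congr rfl fun i _ => by rw [mul_comm]
  rw [this, h2, mul_comm d r]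

theorem bdf_exists_u {k : ℕ} (n : ℕ) (hn : 0 < n) (S : Fin k → ℤ[X])
    (hS : ∀ j, S j ∣ X ^ n - 1) :
    ∃ u : MulAut (Multiplicative (∀ j, ℤ[X] ⧸ Ideal.span {S j})), ∀ (i : ℕ) v, (u ^ i) v =
      Multiplicative.ofAdd (fun j => Ideal.Quotient.mk _ (X ^ i) * (Multiplicative.toAdd v) j) := by
  have hX : ∀ j, Ideal.Quotient.mk (Ideal.span {S j}) (X ^ n) = 1 := by
    intro j
    rw [← map_one (Ideal.Quotient.mk (Ideal.span {S j})), Ideal.Quotient.eq,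
      Ideal.mem_span_singleton]
    exact hS j
  have hX1 : ∀ j, Ideal.Quotient.mk (Ideal.span {S j}) X *
      Ideal.Quotient.mk (Ideal.span {S j}) (X ^ (n - 1)) = 1 := by
    intro j
    rw [← map_mul, ← pow_succ', Nat.sub_add_cancel hn, hX]
  let u : MulAut (Multiplicative (∀ j, ℤ[X] ⧸ Ideal.span {S j})) :=
    { toFun := fun v => Multiplicative.ofAdd
        (fun j => Ideal.Quotient.mk _ X * (Multiplicative.toAdd v) j)
      invFun := fun v => Multiplicative.ofAdd
        (fun j => Ideal.Quotient.mk _ (X ^ (n - 1)) * (Multiplicative.toAdd v) j)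
      left_inv := by
        intro v
        apply Multiplicative.toAdd.injective
        funext j
        simp only [toAdd_ofAdd]
        rw [← mul_assoc, mul_comm (Ideal.Quotient.mk _ (X ^ (n - 1))), hX1, one_mul]
      right_inv := by
        intro v
        apply Multiplicative.toAdd.injective
        funext j
        simp only [toAdd_ofAdd]
        rw [← mul_assoc, hX1, one_mul]
      map_mul' := by
        intro v w
        apply Multiplicative.toAdd.injective
        funext j
        simp only [toAdd_ofAdd, toAdd_mul, Pi.add_apply, mul_add] }
  have hu : ∀ v, u v = Multiplicative.ofAdd
        (fun j => Ideal.Quotient.mk _ X * (Multiplicative.toAdd v) j) := fun v => rfl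
  refine ⟨u, fun i v => ?_⟩
  induction i with
  | zero =>
    apply Multiplicative.toAdd.injective
    funext j
    simp
  | succ i ih =>
    rw [pow_succ', MulAut.mul_apply, ih, hu]
    apply Multiplicative.toAdd.injective
    funext j
    simp only [toAdd_ofAdd]
    rw [← mul_assoc, ← map_mul, pow_succ']

/-- The crossed homomorphism `t ↦ [t γ₀^{-φ t}]`, packaged in a semidirect product. -/
theorem bdf_theta {T : Type*} [Group T] (n : ℕ) [NeZero n] (φ : T →* Multiplicative (ZMod n))
    (c : T) (hc : c ^ n = 1) (hφc : φ c = Multiplicative.ofAdd 1)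
    (σ : MulAut (Abelianization φ.ker))
    (hσ : ∀ x : φ.ker, σ (Abelianization.of x) = Abelianization.of
      (⟨c * (x : T) * c⁻¹, φ.normal_ker.conj_mem _ x.2 _⟩ : φ.ker)) :
    ∃ hσn : σ ^ n = 1, ∃ θ : T →* Abelianization φ.ker ⋊[bdfRho n σ hσn] Multiplicative (ZMod n),
      (∀ t, (θ t).right = φ t) ∧
      (∀ (t : T) (x : φ.ker), (x : T) = t * (c ^ (Multiplicative.toAdd (φ t)).val)⁻¹ →
        (θ t).left = Abelianization.of x) := by
  have hpow : ∀ (i : ℕ) (x y : φ.ker), (y : T) = c ^ i * x * (c ^ i)⁻¹ →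
      (σ ^ i) (Abelianization.of x) = Abelianization.of y := by
    intro i
    induction i with
    | zero =>
      intro x y h
      have : y = x := Subtype.ext (by simpa using h)
      rw [this, pow_zero, MulAut.one_apply]
    | succ i ih =>
      intro x y h
      have hz : c ^ i * (x : T) * (c ^ i)⁻¹ ∈ φ.ker := φ.normal_ker.conj_mem _ x.2 _
      rw [pow_succ', MulAut.mul_apply, ih x ⟨_, hz⟩ rfl, hσ]
      congr 1
      apply Subtype.ext
      rw [h]
      simp only [pow_succ']
      group
  have hσn : σ ^ n = 1 := by
    apply MulEquiv.ext
    intro x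
    obtain ⟨y, rfl⟩ := QuotientGroup.mk_surjective x
    exact hpow n y y (by simp [hc])
  have hmem : ∀ t : T, t * (c ^ (Multiplicative.toAdd (φ t)).val)⁻¹ ∈ φ.ker := by
    intro t
    rw [MonoidHom.mem_ker, map_mul, map_inv, map_pow, hφc, ← ofAdd_nsmul, nsmul_eq_mul, mul_one,
      ZMod.natCast_zmod_val, ofAdd_toAdd, mul_inv_cancel]
  refine ⟨hσn, MonoidHom.mk' (fun t => ⟨Abelianization.of ⟨_, hmem t⟩, φ t⟩) ?_, fun t => rfl, ?_⟩
  · intro s t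
    apply SemidirectProduct.ext
    · rw [SemidirectProduct.mul_left]
      have hz : c ^ (Multiplicative.toAdd (φ s)).val * (t * (c ^ (Multiplicative.toAdd (φ t)).val)⁻¹)
          * (c ^ (Multiplicative.toAdd (φ s)).val)⁻¹ ∈ φ.ker :=
        φ.normal_ker.conj_mem _ (hmem t) _
      have := hpow (Multiplicative.toAdd (φ s)).val ⟨_, hmem t⟩ ⟨_, hz⟩ rfl
      change _ = _ * (σ ^ (Multiplicative.toAdd (φ s)).val) _
      rw [this, ← map_mul]
      refine congrArg Abelianization.of (Subtype.ext ?_)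
      simp only [Subgroup.coe_mul]
      rw [map_mul, toAdd_mul, ZMod.val_add, ← pow_eq_pow_mod _ hc, pow_add]
      simp only [mul_inv_rev, mul_assoc, inv_mul_cancel_left]
    · exact map_mul φ s t
  · intro t x hx
    change Abelianization.of _ = Abelianization.of _
    congr 1
    exact Subtype.ext hx.symm

/-- Theorem 4.3: let `T` be the polygonal group above, `φ : T → ℤ/n` the homomorphism
sending `γ₀ ↦ 1`, `γⱼ ↦ mⱼ`, `γ_∞ ↦ m_∞` (with `m_∞` a unit of `ℤ/n`, the condition of two
points of full ramification, and `rⱼ` the additive order of `mⱼ`), `K = ker φ`, and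
`σ` the automorphism of `K^{ab}` induced by conjugation by `γ₀`. Then there is an
isomorphism of abelian groups
`K^{ab} ≅ ⊕_{j=1}^k ℤ[X]/(1 + X^{n/rⱼ} + X^{2n/rⱼ} + ⋯ + X^{(rⱼ-1)n/rⱼ})`
carrying `σ` to multiplication by `X`; i.e. `H₁(C, ℤ)` is this direct sum of cyclic
`ℤ[ℤ/n]`-modules. -/
theorem abelianization_ker_iso_direct_sum_cyclic (n k : ℕ) (hn : 2 ≤ n) (hk : 1 ≤ k)
    (m : Fin k → ZMod n) (minf : ZMod n) (hminf : IsUnit minf)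
    (hsum : 1 + (∑ j, m j) + minf = 0)
    (r : Fin k → ℕ) (hr : ∀ j, r j = addOrderOf (m j))
    (φ : PresentedGroup (bdfRels n k r) →* Multiplicative (ZMod n))
    (hφ0 : φ (PresentedGroup.of (0 : Fin (k + 2))) = Multiplicative.ofAdd 1)
    (hφj : ∀ j : Fin k,
      φ (PresentedGroup.of (j.succ.castSucc : Fin (k + 2))) = Multiplicative.ofAdd (m j))
    (hφinf : φ (PresentedGroup.of (Fin.last (k + 1))) = Multiplicative.ofAdd minf)
    (σ : Abelianization φ.ker ≃* Abelianization φ.ker)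
    (hσ : ∀ x : φ.ker, σ (Abelianization.of x) = Abelianization.of
      (⟨PresentedGroup.of (0 : Fin (k + 2)) * (x : PresentedGroup (bdfRels n k r)) *
          (PresentedGroup.of (0 : Fin (k + 2)))⁻¹,
        φ.normal_ker.conj_mem _ x.2 _⟩ : φ.ker)) :
    ∃ e : Additive (Abelianization φ.ker) ≃+
        (∀ j : Fin k, Polynomial ℤ ⧸ Ideal.span
          {∑ i ∈ Finset.range (r j), (X : Polynomial ℤ) ^ (i * (n / r j))}),
      ∀ x : Abelianization φ.ker,
        e (Additive.ofMul (σ x)) =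
          fun j => Ideal.Quotient.mk _ (X : Polynomial ℤ) * (e (Additive.ofMul x) j) := by
  classical
  haveI : NeZero n := ⟨by omega⟩
  have hn0 : 0 < n := by omega
  obtain rfl : r = fun j => addOrderOf (m j) := funext hr
  have hrpos : ∀ j, 0 < addOrderOf (m j) := fun j => addOrderOf_pos _
  have hrn : ∀ j, addOrderOf (m j) * (n / addOrderOf (m j)) = n := by
    intro j
    apply Nat.mul_div_cancel'
    have := addOrderOf_dvd_card (x := m j)
    rwa [ZMod.card] at this
  set S : Fin k → ℤ[X] := fun j =>
    ∑ i ∈ Finset.range (addOrderOf (m j)), (X : ℤ[X]) ^ (i * (n / addOrderOf (m j))) with hSdef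
  have hSfull : ∀ j, S j ∣ ∑ i ∈ Finset.range n, (X : ℤ[X]) ^ i := by
    intro j
    have := bdf_poly_full (n / addOrderOf (m j)) (addOrderOf (m j))
    rwa [hrn] at this
  have hSn : ∀ j, S j ∣ X ^ n - 1 := fun j =>
    (hSfull j).trans ⟨X - 1, (geom_sum_mul _ _).symm⟩
  obtain ⟨u, hu⟩ := bdf_exists_u n hn0 S hSn
  have hun : u ^ n = 1 := by
    apply MulEquiv.ext
    intro v
    rw [hu]
    apply Multiplicative.toAdd.injective
    funext j
    have : Ideal.Quotient.mk (Ideal.span {S j}) (X ^ n) = 1 := by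
      rw [← map_one (Ideal.Quotient.mk (Ideal.span {S j})), Ideal.Quotient.eq,
        Ideal.mem_span_singleton]
      exact hSn j
    simp only [toAdd_ofAdd, this, one_mul]
    rfl
  have hu1 : ∀ v, u v = Multiplicative.ofAdd
      (fun j => Ideal.Quotient.mk _ X * (Multiplicative.toAdd v) j) := by
    intro v
    have := hu 1 v
    rwa [pow_one, pow_one] at this
  -- products of powers of u
  have hprod : ∀ (s : Finset ℕ) (e : ℕ → ℕ) v, ∏ i ∈ s, (u ^ e i) v =
      Multiplicative.ofAdd (fun j => Ideal.Quotient.mk _ (∑ i ∈ s, X ^ e i) *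
        (Multiplicative.toAdd v) j) := by
    intro s e v
    apply Multiplicative.toAdd.injective
    funext j
    rw [toAdd_prod, Finset.sum_apply, toAdd_ofAdd, map_sum, Finset.sum_mul]
    refine Finset.sum_congr rfl fun i _ => ?_
    rw [hu]
    rfl
  let c : PresentedGroup (bdfRels n k fun j => addOrderOf (m j)) := PresentedGroup.of 0
  have hc : c ^ n = 1 := by
    have h : PresentedGroup.mk (bdfRels n k fun j => addOrderOf (m j))
        (FreeGroup.of (0 : Fin (k + 2)) ^ n) = 1 :=
      PresentedGroup.one_of_mem (Or.inl (Or.inl (Or.inl rfl)))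
    rwa [map_pow] at h
  have hcj : ∀ j : Fin k, (PresentedGroup.of j.succ.castSucc :
      PresentedGroup (bdfRels n k fun j => addOrderOf (m j))) ^ (addOrderOf (m j)) = 1 := by
    intro j
    have h : PresentedGroup.mk (bdfRels n k fun j => addOrderOf (m j))
        (FreeGroup.of (j.succ.castSucc : Fin (k + 2)) ^ (addOrderOf (m j))) = 1 :=
      PresentedGroup.one_of_mem (Or.inl (Or.inr ⟨j, rfl⟩))
    rwa [map_pow] at h
  -- the homomorphism Ψ
  let g0 : Multiplicative (∀ j, ℤ[X] ⧸ Ideal.span {S j}) ⋊[bdfRho n u hun]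
      Multiplicative (ZMod n) := SemidirectProduct.inr (Multiplicative.ofAdd 1)
  let gj : Fin k → Multiplicative (∀ j, ℤ[X] ⧸ Ideal.span {S j}) ⋊[bdfRho n u hun]
      Multiplicative (ZMod n) := fun j =>
    ⟨Multiplicative.ofAdd (Pi.single j 1), Multiplicative.ofAdd (m j)⟩
  have hg0 : g0 ^ n = 1 := by
    simp only [g0]
    rw [← map_pow, ← ofAdd_nsmul, nsmul_eq_mul, ZMod.natCast_self, zero_mul, ofAdd_zero, map_one]
  have hgj : ∀ j, gj j ^ (addOrderOf (m j)) = 1 := by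
    intro j
    apply SemidirectProduct.ext
    · rw [bdf_left_pow_order n u hun (gj j) (m j) rfl, hprod]
      apply Multiplicative.toAdd.injective
      funext i
      simp only [gj, toAdd_ofAdd, SemidirectProduct.one_left, toAdd_one, Pi.zero_apply]
      rcases eq_or_ne i j with rfl | hij
      · have : Ideal.Quotient.mk (Ideal.span {S i}) (S i) = 0 :=
          Ideal.Quotient.eq_zero_iff_mem.2 (Ideal.mem_span_singleton_self _)
        rw [Pi.single_eq_same, mul_one]
        exact this
      · rw [Pi.single_eq_of_ne hij, mul_zero]
    · change SemidirectProduct.rightHom _ = _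
      rw [map_pow]
      change (Multiplicative.ofAdd (m j)) ^ _ = 1
      rw [← ofAdd_nsmul, addOrderOf_nsmul_eq_zero, ofAdd_zero]
  have hminf' : addOrderOf (-minf) = n := by
    rw [addOrderOf_neg]
    apply Nat.dvd_antisymm
    · have := addOrderOf_dvd_card (x := minf)
      rwa [ZMod.card] at this
    · have h := addOrderOf_nsmul_eq_zero minf
      rw [nsmul_eq_mul, hminf.mul_left_eq_zero] at h
      exact (ZMod.natCast_eq_zero_iff _ _).1 h
  have hpr : (g0 * (List.ofFn gj).prod).right = Multiplicative.ofAdd (-minf) := by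
    rw [← SemidirectProduct.rightHom_eq_right, map_mul, map_list_prod, List.map_ofFn, List.prod_ofFn]
    apply Multiplicative.toAdd.injective
    rw [toAdd_mul, toAdd_prod]
    change 1 + ∑ j, m j = -minf
    exact eq_neg_of_add_eq_zero_left hsum
  have hgp : (g0 * (List.ofFn gj).prod) ^ n = 1 := by
    apply SemidirectProduct.ext
    · have h := bdf_left_pow_order n u hun (g0 * (List.ofFn gj).prod) (-minf) hpr
      rw [hminf', Nat.div_self hn0, hprod] at h
      rw [h]
      apply Multiplicative.toAdd.injective
      funext i
      have : Ideal.Quotient.mk (Ideal.span {S i}) (∑ i ∈ Finset.range n, X ^ (i * 1)) = 0 := by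
        rw [Ideal.Quotient.eq_zero_iff_mem, Ideal.mem_span_singleton]
        simp only [mul_one]
        exact hSfull i
      rw [toAdd_ofAdd, this, zero_mul]
      rfl
    · change SemidirectProduct.rightHom _ = _
      rw [map_pow]
      change (g0 * (List.ofFn gj).prod).right ^ _ = 1
      rw [hpr, ← ofAdd_nsmul, nsmul_eq_mul, ZMod.natCast_self, zero_mul, ofAdd_zero]
  obtain ⟨Ψ, hΨ0, hΨj⟩ := bdf_exists_hom (n := n) (r := fun j => addOrderOf (m j)) g0 gj hg0 hgj hgp
  have hΨφ : ∀ t, (Ψ t).right = φ t := by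
    have : SemidirectProduct.rightHom.comp Ψ = φ := by
      apply bdf_hom_ext
      · rw [MonoidHom.comp_apply, hΨ0, hφ0]; rfl
      · intro j
        rw [MonoidHom.comp_apply, hΨj, hφj]; rfl
    intro t
    exact DFunLike.congr_fun this t
  obtain ⟨hσn, θ, hθr, hθl⟩ := bdf_theta n φ c hc hφ0 σ hσ
  -- α
  let α0 : φ.ker →* Multiplicative (∀ j, ℤ[X] ⧸ Ideal.span {S j}) :=
    MonoidHom.mk' (fun x => (Ψ x).left) (by
      intro x y
      have hx : (Ψ x).right = 1 := by rw [hΨφ]; exact x.2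
      rw [Subgroup.coe_mul, map_mul, SemidirectProduct.mul_left, hx, map_one, MulAut.one_apply])
  let α : Abelianization φ.ker →* Multiplicative (∀ j, ℤ[X] ⧸ Ideal.span {S j}) :=
    Abelianization.lift α0
  have hα : ∀ x : φ.ker, α (Abelianization.of x) = (Ψ x).left := fun x =>
    Abelianization.lift_apply_of α0 x
  have hval1 : (1 : ZMod n).val = 1 := by
    haveI : Fact (1 < n) := ⟨by omega⟩
    exact ZMod.val_one n
  have hασ : ∀ y, α (σ y) = u (α y) := by
    intro y
    obtain ⟨x, rfl⟩ := QuotientGroup.mk_surjective y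
    change α (σ (Abelianization.of x)) = u (α (Abelianization.of x))
    rw [hσ, hα, hα]
    have hx : Ψ x = SemidirectProduct.inl (Ψ x).left := by
      apply SemidirectProduct.ext
      · rfl
      · rw [hΨφ]; exact x.2
    simp only [map_mul, map_inv]
    rw [hΨ0, hx]
    simp only [g0]
    rw [← map_inv, ← SemidirectProduct.inl_aut, SemidirectProduct.left_inl,
      SemidirectProduct.left_inl]
    change (u ^ (1 : ZMod n).val) _ = _
    rw [hval1, pow_one]
  -- the generators x_j
  let xj : Fin k → Abelianization φ.ker := fun j => (θ (PresentedGroup.of j.succ.castSucc)).left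
  have hαx : ∀ j, α (xj j) = Multiplicative.ofAdd (Pi.single j 1) := by
    intro j
    have hmem : (PresentedGroup.of j.succ.castSucc) * (c ^ (m j).val)⁻¹ ∈ φ.ker := by
      rw [MonoidHom.mem_ker, map_mul, map_inv, map_pow, hφ0, hφj, ← ofAdd_nsmul, nsmul_eq_mul,
        mul_one, ZMod.natCast_zmod_val, mul_inv_cancel]
    have h := hθl (PresentedGroup.of j.succ.castSucc) ⟨_, hmem⟩ (by rw [hφj, toAdd_ofAdd])
    simp only [xj]
    rw [h, hα]
    simp only [map_mul, map_inv, map_pow]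
    rw [hΨ0, hΨj]
    simp only [g0]
    rw [← map_pow, ← map_inv, SemidirectProduct.mul_left, SemidirectProduct.left_inr, map_one,
      mul_one]
  -- β
  let s : Module.End ℤ (Additive (Abelianization φ.ker)) :=
    (MonoidHom.toAdditive σ.toMonoidHom).toIntLinearMap
  have hs : ∀ y, s (Additive.ofMul y) = Additive.ofMul (σ y) := fun y => rfl
  have hsp : ∀ (i : ℕ) y, (s ^ i) (Additive.ofMul y) = Additive.ofMul ((σ ^ i) y) := by
    intro i
    induction i with
    | zero => intro y; rfl
    | succ i ih =>
      intro y
      rw [pow_succ', Module.End.mul_apply, ih, hs, pow_succ', MulAut.mul_apply]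
  have hxrel : ∀ j, aeval s (S j) (Additive.ofMul (xj j)) = 0 := by
    intro j
    have h1 : θ (PresentedGroup.of j.succ.castSucc) ^ (addOrderOf (m j)) = 1 := by
      rw [← map_pow, hcj, map_one]
    have h2 := bdf_left_pow_order n σ hσn (θ (PresentedGroup.of j.succ.castSucc)) (m j)
      (by rw [hθr, hφj])
    rw [h1, SemidirectProduct.one_left] at h2
    simp only [hSdef, map_sum, map_pow, aeval_X, LinearMap.sum_apply, hsp]
    rw [← ofMul_prod, ← h2, ofMul_one]
  choose βj hβ1 hβX using fun j => bdf_quot_hom s (Additive.ofMul (xj j)) (S j) (hxrel j)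
  let β : (∀ j, ℤ[X] ⧸ Ideal.span {S j}) →+ Additive (Abelianization φ.ker) :=
    { toFun := fun v => ∑ j, βj j (v j)
      map_zero' := by simp
      map_add' := by intro v w; simp [Finset.sum_add_distrib] }
  have hβs : ∀ j p, β (Pi.single j p) = βj j p := by
    intro j p
    change ∑ i, βj i ((Pi.single j p : ∀ j, ℤ[X] ⧸ Ideal.span {S j}) i) = _
    rw [Finset.sum_eq_single j]
    · rw [Pi.single_eq_same]
    · intro i _ hi
      rw [Pi.single_eq_of_ne hi, map_zero]
    · simp
  have hβu : ∀ v, β (Multiplicative.toAdd (u v)) = s (β (Multiplicative.toAdd v)) := by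
    intro v
    rw [hu1]
    change ∑ i, βj i (Ideal.Quotient.mk _ X * (Multiplicative.toAdd v) i) =
      s (∑ i, βj i ((Multiplicative.toAdd v) i))
    rw [map_sum]
    exact Finset.sum_congr rfl fun i _ => hβX i _
  -- α ∘ β = id
  let αa : Additive (Abelianization φ.ker) →+ (∀ j, ℤ[X] ⧸ Ideal.span {S j}) :=
    MonoidHom.toAdditiveLeft α
  have hαa : ∀ y, αa y = Multiplicative.toAdd (α (Additive.toMul y)) := fun y => rfl
  have hαas : ∀ y, αa (s y) = fun j => Ideal.Quotient.mk _ X * αa y j := by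
    intro y
    rw [hαa]
    change Multiplicative.toAdd (α (σ (Additive.toMul y))) = _
    rw [hασ, hu1]
    rfl
  have hαβj : ∀ j, αa.comp (βj j) = AddMonoidHom.single (fun j => ℤ[X] ⧸ Ideal.span {S j}) j := by
    intro j
    apply bdf_quot_hom_ext (fun v => fun j => Ideal.Quotient.mk _ X * v j)
    · rw [AddMonoidHom.comp_apply, hβ1, hαa, toMul_ofMul, hαx]
      rfl
    · intro p
      rw [AddMonoidHom.comp_apply, hβX, hαas]
      rfl
    · intro p
      funext i
      simp only [AddMonoidHom.single_apply]
      rcases eq_or_ne i j with rfl | hij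
      · rw [Pi.single_eq_same, Pi.single_eq_same]
      · rw [Pi.single_eq_of_ne hij, Pi.single_eq_of_ne hij, mul_zero]
  have hαβ : ∀ v, αa (β v) = v := by
    intro v
    change αa (∑ j, βj j (v j)) = v
    rw [map_sum]
    have : ∀ j, αa (βj j (v j)) = Pi.single j (v j) := fun j =>
      DFunLike.congr_fun (hαβj j) (v j)
    simp only [this]
    exact Finset.univ_sum_single v
  -- β ∘ α = id
  let βm : Multiplicative (∀ j, ℤ[X] ⧸ Ideal.span {S j}) →* Abelianization φ.ker :=
    AddMonoidHom.toMultiplicativeLeft β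
  have hβm : ∀ v, βm v = Additive.toMul (β (Multiplicative.toAdd v)) := fun v => rfl
  have hβmu : ∀ v, βm (u v) = σ (βm v) := by
    intro v
    rw [hβm, hβu]
    rfl
  have hβmp : ∀ (i : ℕ) v, βm ((u ^ i) v) = (σ ^ i) (βm v) := by
    intro i
    induction i with
    | zero => intro v; rfl
    | succ i ih =>
      intro v
      rw [pow_succ', MulAut.mul_apply, hβmu, ih, pow_succ', MulAut.mul_apply]
  let Φ : PresentedGroup (bdfRels n k fun j => addOrderOf (m j)) →*
      Abelianization φ.ker ⋊[bdfRho n σ hσn] Multiplicative (ZMod n) :=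
    MonoidHom.mk' (fun t => ⟨βm (Ψ t).left, (Ψ t).right⟩) (by
      intro a b
      apply SemidirectProduct.ext
      · simp only [map_mul, SemidirectProduct.mul_left]
        congr 1
        exact hβmp _ _
      · simp only [map_mul, SemidirectProduct.mul_right])
  have hΦθ : Φ = θ := by
    apply bdf_hom_ext
    · apply SemidirectProduct.ext
      · change βm (Ψ _).left = _
        rw [hΨ0]
        simp only [g0]
        rw [SemidirectProduct.left_inr, map_one]
        rw [hθl (PresentedGroup.of 0) 1 (by
          rw [hφ0, toAdd_ofAdd, hval1, pow_one, OneMemClass.coe_one]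
          exact (mul_inv_cancel _).symm), map_one]
      · change (Ψ _).right = _
        rw [hΨφ, hθr]
    · intro j
      apply SemidirectProduct.ext
      · change βm (Ψ _).left = xj j
        rw [hΨj, hβm]
        simp only [gj]
        rw [toAdd_ofAdd, hβs, hβ1, toMul_ofMul]
      · change (Ψ _).right = _
        rw [hΨφ, hθr]
  have hβα : ∀ y, β (αa y) = y := by
    intro y
    obtain ⟨x, hx⟩ := QuotientGroup.mk_surjective (Additive.toMul y)
    have hx' : y = Additive.ofMul (Abelianization.of x) := hx.symm
    rw [hx', hαa, toMul_ofMul, hα]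
    have h1 : (Φ x).left = (θ x).left := by rw [hΦθ]
    have hx1 : φ x = 1 := x.2
    rw [hθl x x (by rw [hx1, toAdd_one, ZMod.val_zero, pow_zero, inv_one, mul_one])] at h1
    exact congrArg Additive.ofMul h1
  refine ⟨{ αa with
    invFun := β
    left_inv := hβα
    right_inv := hαβ }, fun x => ?_⟩
  exact hαas (Additive.ofMul x)
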